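/- Fix α ∈ [0,1]. The alternative mollified irrigation costs Ẽ^α_ε Γ-converge to E^α on IP(μ) as ε → 0, in the following sense. For every sequence ε_n → 0+: (Γ1) for any sequence of arc-length-parameterized irrigation plans χ_n ∈ IP(μ) with χ_n → χ ∈ IP(μ) and whose stopping times satisfy ∫_Θ T_n(θ) dθ ≤ C uniformly in n, one has liminf_{n→∞} Ẽ^α_{ε_n}(χ_n) ≥ E^α(χ); (Γ2) for every χ ∈ IP(μ) there exists a sequence χ_n ∈ IP(μ) with χ_n → χ and limsup_{n→∞} Ẽ^α_{ε_n}(χ_n) ≤ E^α(χ). -/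

import Mathlib

open MeasureTheory Filter Topology
open scoped ENNReal NNReal

noncomputable section

/-- Euclidean space `ℝ^d`. -/
abbrev Euc (d : ℕ) : Type := EuclideanSpace ℝ (Fin d)

/-- `Θ = [0, M]` where `M = μ(ℝ^d)` is the total mass. -/
def Theta {d : ℕ} (μ : Measure (Euc d)) : Set ℝ := Set.Icc 0 (μ Set.univ).toReal

/-- The stopping time `T(θ)` of a Lagrangian path. -/
def stopTime {d : ℕ} (χ : ℝ → ℝ → Euc d) (θ : ℝ) : ℝ :=
  sInf {t : ℝ | 0 < t ∧ ∀ t' ≥ t, χ θ t' = χ θ t}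

/-- An admissible irrigation plan for the measure `μ`: measurable, `1`-Lipschitz and eventually
constant paths, all starting at the origin, whose final positions push the Lebesgue measure
on `Θ = [0,M]` forward onto `μ`. -/
structure IsIrrigPlan {d : ℕ} (μ : Measure (Euc d)) (χ : ℝ → ℝ → Euc d) : Prop where
  measurable : Measurable (Function.uncurry χ)
  lipschitz : ∀ θ ∈ Theta μ, LipschitzWith 1 (χ θ)
  eventuallyConst : ∀ θ ∈ Theta μ, ∃ t, 0 < t ∧ ∀ t' ≥ t, χ θ t' = χ θ t
  init : ∀ θ ∈ Theta μ, χ θ 0 = 0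
  pushforward :
    Measure.map (fun θ => χ θ (stopTime χ θ)) (volume.restrict (Theta μ)) = μ

/-- The multiplicity `|x|_χ`: the measure of the set of particles passing through `x`. -/
def mult {d : ℕ} (μ : Measure (Euc d)) (χ : ℝ → ℝ → Euc d) (x : Euc d) : ℝ≥0∞ :=
  volume {θ ∈ Theta μ | ∃ t, 0 ≤ t ∧ χ θ t = x}

/-- The `α`-irrigation cost `E^α(χ)`. -/
def irrCost {d : ℕ} (μ : Measure (Euc d)) (α : ℝ) (χ : ℝ → ℝ → Euc d) : ℝ≥0∞ :=
  ∫⁻ θ in Theta μ, ∫⁻ t in Set.Ici (0:ℝ),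
    (mult μ χ (χ θ t)) ^ (α - 1) * (‖deriv (χ θ) t‖₊ : ℝ≥0∞)

/-- `ρ(θ,x) = min_{t ≥ 0} |χ(θ,t) − x|`. -/
def pathInfDist {d : ℕ} (χ : ℝ → ℝ → Euc d) (θ : ℝ) (x : Euc d) : ℝ :=
  ⨅ t : Set.Ici (0:ℝ), dist (χ θ (t : ℝ)) x

/-- A mollifying kernel: a nonnegative, non-increasing, Lipschitz function on `ℝ₊`
with `J(0) = 1` and `J(r) → 0` as `r → ∞`. -/
def MollKernel (J : ℝ → ℝ) : Prop :=
  (∀ r, 0 ≤ r → 0 ≤ J r) ∧ AntitoneOn J (Set.Ici 0) ∧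
    (∃ K : ℝ≥0, LipschitzOnWith K J (Set.Ici 0)) ∧ J 0 = 1 ∧ Tendsto J atTop (𝓝 0)

/-- The mollified multiplicity `W_ε(x,χ) = ∫_Θ J_ε(min_{t≥0} |χ(θ,t) − x|) dθ`. -/
def Wmol {d : ℕ} (μ : Measure (Euc d)) (J : ℝ → ℝ) (ε : ℝ) (χ : ℝ → ℝ → Euc d)
    (x : Euc d) : ℝ≥0∞ :=
  ∫⁻ θ in Theta μ, ENNReal.ofReal (J (pathInfDist χ θ x / ε))

/-- The mollified irrigation cost `E^α_ε(χ)`. -/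
def Emol {d : ℕ} (μ : Measure (Euc d)) (J : ℝ → ℝ) (α ε : ℝ)
    (χ : ℝ → ℝ → Euc d) : ℝ≥0∞ :=
  ∫⁻ θ in Theta μ, ∫⁻ t in Set.Ici (0:ℝ),
    (Wmol μ J ε χ (χ θ t)) ^ (α - 1) * (‖deriv (χ θ) t‖₊ : ℝ≥0∞)

/-- The distance `d(γ₀,γ₁) = sup_{k ≥ 1} (1/k) ‖γ₀ − γ₁‖_{L^∞([0,k])}` between paths. -/
def dPath {d : ℕ} (γ₀ γ₁ : ℝ → Euc d) : ℝ :=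
  ⨆ k : ℕ+, (1 / ((k : ℕ) : ℝ)) *
    ⨆ t : Set.Icc (0:ℝ) ((k : ℕ) : ℝ), dist (γ₀ (t : ℝ)) (γ₁ (t : ℝ))

/-- Convergence `χ_n → χ` of irrigation plans: `d(χ_n(θ,·), χ(θ,·)) → 0` for a.e. `θ ∈ Θ`. -/
def PlansTendsto {d : ℕ} (μ : Measure (Euc d)) (χs : ℕ → ℝ → ℝ → Euc d)
    (χ : ℝ → ℝ → Euc d) : Prop :=
  ∀ᵐ θ ∂(volume.restrict (Theta μ)),
    Tendsto (fun n => dPath (χs n θ) (χ θ)) atTop (𝓝 0)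

/-- The plan `χ` is parameterized by arc-length: for a.e. `t`, `|∂_t χ(θ,t)| = 1` for
`0 < t < T(θ)` and `|∂_t χ(θ,t)| = 0` for `t > T(θ)`. -/
def ArcLength {d : ℕ} (μ : Measure (Euc d)) (χ : ℝ → ℝ → Euc d) : Prop :=
  ∀ θ ∈ Theta μ, ∀ᵐ t ∂(volume : Measure ℝ),
    (0 < t → t < stopTime χ θ → ‖deriv (χ θ) t‖ = 1) ∧
    (stopTime χ θ < t → ‖deriv (χ θ) t‖ = 0)

/-- An alternative mollifying kernel: smooth, positive, strictly decreasing on `ℝ₊`,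
with `1 ≤ ∫₀^∞ J(r) dr < ∞`. -/
def MollKernel2 (J : ℝ → ℝ) : Prop :=
  ContDiffOn ℝ (⊤ : ℕ∞) J (Set.Ici 0) ∧ (∀ r, 0 ≤ r → 0 < J r) ∧ StrictAntiOn J (Set.Ici 0) ∧
    IntegrableOn J (Set.Ioi 0) volume ∧ 1 ≤ ∫ r in Set.Ioi (0:ℝ), J r

/-- The alternative mollified multiplicity
`W̃_ε(x,χ) = ∫_Θ min{1, ∫₀^∞ (1/ε) J_ε(|χ(θ,t) − x|) |∂_t χ(θ,t)| dt} dθ`. -/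
def Wtil {d : ℕ} (μ : Measure (Euc d)) (J : ℝ → ℝ) (ε : ℝ) (χ : ℝ → ℝ → Euc d)
    (x : Euc d) : ℝ≥0∞ :=
  ∫⁻ θ in Theta μ,
    min 1 (∫⁻ t in Set.Ici (0:ℝ),
      ENNReal.ofReal ((1 / ε) * J (dist (χ θ t) x / ε)) * (‖deriv (χ θ) t‖₊ : ℝ≥0∞))

/-- The alternative mollified irrigation cost `Ẽ^α_ε(χ)`. -/
def Etil {d : ℕ} (μ : Measure (Euc d)) (J : ℝ → ℝ) (α ε : ℝ)
    (χ : ℝ → ℝ → Euc d) : ℝ≥0∞ :=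
  ∫⁻ θ in Theta μ, ∫⁻ t in Set.Ici (0:ℝ),
    (Wtil μ J ε χ (χ θ t)) ^ (α - 1) * (‖deriv (χ θ) t‖₊ : ℝ≥0∞)

lemma MollKernel2.continuous_max {J : ℝ → ℝ} (hJ : MollKernel2 J) :
    Continuous fun r => J (max r 0) := by
  rw [← continuousOn_univ]
  exact hJ.1.continuousOn.comp (by fun_prop) fun r _ => le_max_right r 0

lemma MollKernel2.tendsto_intervalIntegral {J : ℝ → ℝ} (hJ : MollKernel2 J) :
    Tendsto (fun r => ∫ s in (0:ℝ)..r, J s) atTop (𝓝 (∫ s in Set.Ioi (0:ℝ), J s)) :=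
  intervalIntegral_tendsto_integral_Ioi 0 hJ.2.2.2.1 tendsto_id

lemma MollKernel2.intervalIntegrable {J : ℝ → ℝ} (hJ : MollKernel2 J) {a b : ℝ}
    (ha : 0 ≤ a) (hb : 0 ≤ b) : IntervalIntegrable J volume a b :=
  (hJ.1.continuousOn.mono fun _ hx => le_trans (le_min ha hb) hx.1).intervalIntegrable

lemma MollKernel2.tendsto_mul_self {J : ℝ → ℝ} (hJ : MollKernel2 J) :
    Tendsto (fun r => r * J r) atTop (𝓝 0) := by
  have hF := hJ.tendsto_intervalIntegral
  have h2 : Tendsto (fun r : ℝ => r / 2) atTop atTop :=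
    tendsto_id.atTop_div_const (by norm_num)
  have h3 : Tendsto (fun r => 2 * ((∫ s in (0:ℝ)..r, J s) - ∫ s in (0:ℝ)..(r / 2), J s))
      atTop (𝓝 0) := by
    simpa using ((hF.sub (hF.comp h2)).const_mul 2)
  refine tendsto_of_tendsto_of_tendsto_of_le_of_le' tendsto_const_nhds h3 ?_ ?_
  · filter_upwards [eventually_ge_atTop 0] with r hr
    exact mul_nonneg hr (hJ.2.1 r hr).le
  · filter_upwards [eventually_ge_atTop 0] with r hr
    have hr2 : 0 ≤ r / 2 := by positivity
    rw [intervalIntegral.integral_interval_sub_left (hJ.intervalIntegrable le_rfl hr)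
      (hJ.intervalIntegrable le_rfl hr2)]
    have : ∫ _ in (r / 2)..r, J r ≤ ∫ s in (r / 2)..r, J s := by
      refine intervalIntegral.integral_mono_on (by linarith) (by simp)
        (hJ.intervalIntegrable hr2 hr) fun s hs => ?_
      exact hJ.2.2.1.antitoneOn (hr2.trans hs.1) hr hs.2
    simp only [intervalIntegral.integral_const, smul_eq_mul] at this
    nlinarith

lemma norm_hasDerivAt_le_of_dist_le {E F : Type*} [NormedAddCommGroup E] [NormedSpace ℝ E]
    [NormedAddCommGroup F] [NormedSpace ℝ F] {f : ℝ → E} {g : ℝ → F} {f' : E} {g' : F} {t : ℝ}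
    (hf : HasDerivAt f f' t) (hg : HasDerivAt g g' t)
    (h : ∀ s, dist (f s) (f t) ≤ dist (g s) (g t)) : ‖f'‖ ≤ ‖g'‖ := by
  refine le_of_tendsto_of_tendsto' (hasDerivAt_iff_tendsto_slope.1 hf).norm
    (hasDerivAt_iff_tendsto_slope.1 hg).norm fun s => ?_
  simp only [slope, vsub_eq_sub, norm_smul, ← dist_eq_norm]
  exact mul_le_mul_of_nonneg_left (h s) (norm_nonneg _)

/-- Every passage of a path from distance `δ` down to the point `x` contributes at least
`∫₀^{δ/ε} J` to the mollified line integral around `x`. -/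
lemma MollKernel2.ofReal_integral_le_lintegral {d : ℕ} {J : ℝ → ℝ} (hJ : MollKernel2 J) {ε : ℝ}
    (hε : 0 < ε) {γ : ℝ → Euc d} (hγ : LipschitzWith 1 γ) {x : Euc d} {t₀ t₁ δ : ℝ}
    (h₀ : 0 ≤ t₀) (h₁ : 0 ≤ t₁) (hx : γ t₀ = x) (hδ : 0 ≤ δ) (hd : δ ≤ dist (γ t₁) x) :
    ENNReal.ofReal (∫ s in (0:ℝ)..(δ / ε), J s) ≤
      ∫⁻ t in Set.Ici (0:ℝ),
        ENNReal.ofReal ((1 / ε) * J (dist (γ t) x / ε)) * (‖deriv γ t‖₊ : ℝ≥0∞) := by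
  set j : ℝ → ℝ := fun r => (1 / ε) * J (max (r / ε) 0) with hj
  have hjc : Continuous j := continuous_const.mul (hJ.continuous_max.comp (by fun_prop))
  have hj0 : ∀ r, 0 ≤ j r := fun r =>
    mul_nonneg (by positivity) (hJ.2.1 _ (le_max_right _ _)).le
  have hjle : ∀ r, j r ≤ (1 / ε) * J 0 := fun r =>
    mul_le_mul_of_nonneg_left
      (hJ.2.2.1.antitoneOn Set.self_mem_Ici (Set.mem_Ici.2 (le_max_right _ _))
        (le_max_right _ _))
      (by positivity)
  set G : ℝ → ℝ := fun r => ∫ s in (0:ℝ)..r, j s with hG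
  have hGd : ∀ r, HasDerivAt G (j r) r := fun r =>
    intervalIntegral.integral_hasDerivAt_right (hjc.intervalIntegrable _ _)
      (hjc.stronglyMeasurableAtFilter _ _) hjc.continuousAt
  have hGl : LipschitzWith (Real.toNNReal ((1 / ε) * J 0)) G := by
    refine lipschitzWith_of_nnnorm_deriv_le (fun r => (hGd r).differentiableAt) fun r => ?_
    rw [(hGd r).deriv, ← NNReal.coe_le_coe, coe_nnnorm, Real.norm_of_nonneg (hj0 r)]
    exact (hjle r).trans (Real.le_coe_toNNReal _)
  set ρ : ℝ → ℝ := fun t => dist (γ t) x with hρ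
  have hρl : LipschitzWith 1 ρ := by
    have h1 := (LipschitzWith.dist_left x).comp hγ
    rwa [mul_one] at h1
  have hfl : LipschitzWith (Real.toNNReal ((1 / ε) * J 0) * 1) (G ∘ ρ) := hGl.comp hρl
  have hftc := (hfl.lipschitzOnWith (s := Set.uIcc t₀ t₁)).absolutelyContinuousOnInterval
    |>.integral_deriv_eq_sub
  have hρ0 : ρ t₀ = 0 := by simp [hρ, hx]
  have hG0 : G 0 = 0 := by simp [hG]
  have hGm : Monotone G := monotone_of_hasDerivAt_nonneg hGd hj0
  have hGδ : G δ = ∫ s in (0:ℝ)..(δ / ε), J s := by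
    have h1 : G δ = ∫ s in (0:ℝ)..δ, (1 / ε) * J (s / ε) := by
      refine intervalIntegral.integral_congr fun s hs => ?_
      rw [Set.uIcc_of_le hδ] at hs
      have : 0 ≤ s / ε := div_nonneg hs.1 hε.le
      simp [hj, max_eq_left this]
    rw [h1, intervalIntegral.integral_const_mul, intervalIntegral.integral_comp_div _ hε.ne',
      zero_div, smul_eq_mul, ← mul_assoc, one_div_mul_cancel hε.ne', one_mul]
  have hle : (∫ s in (0:ℝ)..(δ / ε), J s) ≤ ‖∫ t in t₀..t₁, deriv (G ∘ ρ) t‖ := by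
    rw [hftc, ← hGδ]
    simp only [Function.comp_apply, hρ0, hG0, sub_zero]
    exact (hGm hd).trans (le_abs_self _)
  have hae : ∀ᵐ t ∂(volume : Measure ℝ), ‖deriv (G ∘ ρ) t‖ₑ ≤
      ENNReal.ofReal ((1 / ε) * J (dist (γ t) x / ε)) * (‖deriv γ t‖₊ : ℝ≥0∞) := by
    filter_upwards [hρl.ae_differentiableAt (μ := volume), hγ.ae_differentiableAt (μ := volume)]
      with t ht1 ht2
    have hc : HasDerivAt (G ∘ ρ) (j (ρ t) * deriv ρ t) t := (hGd _).comp t ht1.hasDerivAt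
    have hn : ‖deriv ρ t‖ ≤ ‖deriv γ t‖ :=
      norm_hasDerivAt_le_of_dist_le ht1.hasDerivAt ht2.hasDerivAt fun s => by
        simpa [hρ, Real.dist_eq] using abs_dist_sub_le (γ s) (γ t) x
    have hjρ : j (ρ t) = (1 / ε) * J (dist (γ t) x / ε) := by
      simp only [hj, hρ, max_eq_left (div_nonneg dist_nonneg hε.le)]
    rw [hc.deriv, enorm_mul, Real.enorm_eq_ofReal (hj0 _), hjρ]
    gcongr
    exact ENNReal.coe_le_coe.2 hn
  calc ENNReal.ofReal (∫ s in (0:ℝ)..(δ / ε), J s)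
      ≤ ENNReal.ofReal ‖∫ t in t₀..t₁, deriv (G ∘ ρ) t‖ := ENNReal.ofReal_le_ofReal hle
    _ = ‖∫ t in Set.uIoc t₀ t₁, deriv (G ∘ ρ) t‖ₑ := by
      rw [intervalIntegral.norm_intervalIntegral_eq, ofReal_norm]
    _ ≤ ∫⁻ t in Set.uIoc t₀ t₁, ‖deriv (G ∘ ρ) t‖ₑ := enorm_integral_le_lintegral_enorm _
    _ ≤ ∫⁻ t in Set.Ici (0:ℝ), ‖deriv (G ∘ ρ) t‖ₑ :=
      lintegral_mono_set fun t ht => (le_min h₀ h₁).trans ht.1.le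
    _ ≤ _ := lintegral_mono_ae (ae_restrict_of_ae hae)

lemma volume_Theta_ne_top {d : ℕ} (μ : Measure (Euc d)) : volume (Theta μ) ≠ ∞ := by
  simp [Theta]

lemma measurableSet_Theta {d : ℕ} (μ : Measure (Euc d)) : MeasurableSet (Theta μ) :=
  measurableSet_Icc

lemma nnnorm_deriv_le_one {d : ℕ} {γ : ℝ → Euc d} (h : LipschitzWith 1 γ) (t : ℝ) :
    (‖deriv γ t‖₊ : ℝ≥0∞) ≤ 1 := by
  exact_mod_cast norm_deriv_le_of_lipschitz h (x₀ := t)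

/-- The path speed agrees almost everywhere with a jointly measurable function. -/
lemma IsIrrigPlan.exists_measurable_speed {d : ℕ} {μ : Measure (Euc d)} {χ : ℝ → ℝ → Euc d}
    (h : IsIrrigPlan μ χ) : ∃ D : ℝ × ℝ → ℝ≥0∞, Measurable D ∧
      ∀ θ ∈ Theta μ, ∀ᵐ t ∂(volume : Measure ℝ), (‖deriv (χ θ) t‖₊ : ℝ≥0∞) = D (θ, t) := by
  refine ⟨fun p => limsup (fun n : ℕ => ‖(((n : ℝ) + 1)⁻¹)⁻¹ •
    (χ p.1 (p.2 + ((n : ℝ) + 1)⁻¹) - χ p.1 p.2)‖ₑ) atTop, ?_, fun θ hθ => ?_⟩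
  · refine Measurable.limsup fun n => ?_
    have h1 : Measurable fun p : ℝ × ℝ => χ p.1 (p.2 + ((n : ℝ) + 1)⁻¹) :=
      h.measurable.comp (by fun_prop : Measurable fun p : ℝ × ℝ => (p.1, p.2 + ((n : ℝ) + 1)⁻¹))
    have h2 : Measurable fun p : ℝ × ℝ => χ p.1 p.2 := h.measurable
    have h3 : Measurable fun p : ℝ × ℝ => (((n : ℝ) + 1)⁻¹)⁻¹ •
        (χ p.1 (p.2 + ((n : ℝ) + 1)⁻¹) - χ p.1 p.2) :=
      (h1.sub h2).const_smul ((((n : ℝ) + 1)⁻¹)⁻¹)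
    exact measurable_enorm.comp h3
  · filter_upwards [(h.lipschitz θ hθ).ae_differentiableAt (μ := volume)] with t ht
    have h1 := ht.hasDerivAt.tendsto_slope_zero_right
    have h2 : Tendsto (fun n : ℕ => ((n : ℝ) + 1)⁻¹) atTop (𝓝[>] 0) := by
      refine tendsto_nhdsWithin_iff.2 ⟨?_, Eventually.of_forall fun n => ?_⟩
      · simpa using tendsto_one_div_add_atTop_nhds_zero_nat (𝕜 := ℝ)
      · simp only [Set.mem_Ioi]; positivity
    exact ((h1.comp h2).enorm.limsup_eq).symm

lemma measurable_mollifier {d : ℕ} {J : ℝ → ℝ} (hJ : MollKernel2 J) {ε : ℝ} (hε : 0 < ε) {β : Type*}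
    [MeasurableSpace β] {f g : β → Euc d} (hf : Measurable f) (hg : Measurable g) :
    Measurable fun b => ENNReal.ofReal ((1 / ε) * J (dist (f b) (g b) / ε)) := by
  have h1 : (fun b => ENNReal.ofReal ((1 / ε) * J (dist (f b) (g b) / ε))) =
      fun b => ENNReal.ofReal ((1 / ε) * J (max (dist (f b) (g b) / ε) 0)) := by
    funext b
    rw [max_eq_left (div_nonneg dist_nonneg hε.le)]
  rw [h1]
  exact ((hJ.continuous_max.measurable.comp ((hf.dist hg).div_const ε)).const_mul _).ennreal_ofReal

/-- Mollified line integrals over a set `s` of times are measurable in the base point and the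
particle label jointly, up to modification outside `Theta μ`. -/
lemma IsIrrigPlan.exists_measurable_lineIntegral {d : ℕ} {μ : Measure (Euc d)}
    {χ : ℝ → ℝ → Euc d} (h : IsIrrigPlan μ χ) {J : ℝ → ℝ} (hJ : MollKernel2 J) {ε : ℝ}
    (hε : 0 < ε) (s : Set ℝ) :
    ∃ I : Euc d × ℝ → ℝ≥0∞, Measurable I ∧ ∀ x, ∀ θ ∈ Theta μ,
      (∫⁻ t in s, ENNReal.ofReal ((1 / ε) * J (dist (χ θ t) x / ε)) *
        (‖deriv (χ θ) t‖₊ : ℝ≥0∞)) = I (x, θ) := by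
  obtain ⟨D, hD, hDe⟩ := h.exists_measurable_speed
  refine ⟨fun p => ∫⁻ t in s, ENNReal.ofReal ((1 / ε) * J (dist (χ p.2 t) p.1 / ε)) *
    D (p.2, t), ?_, fun x θ hθ => lintegral_congr_ae ?_⟩
  · refine Measurable.lintegral_prod_right'
      (f := fun q : (Euc d × ℝ) × ℝ => ENNReal.ofReal ((1 / ε) *
        J (dist (χ q.1.2 q.2) q.1.1 / ε)) * D (q.1.2, q.2)) ?_
    have h2 : Measurable fun q : (Euc d × ℝ) × ℝ => χ q.1.2 q.2 :=
      h.measurable.comp (by fun_prop : Measurable fun q : (Euc d × ℝ) × ℝ => (q.1.2, q.2))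
    exact (measurable_mollifier hJ hε h2 (by fun_prop)).mul (hD.comp (by fun_prop))
  · filter_upwards [ae_restrict_of_ae (hDe θ hθ)] with t ht
    rw [ht]

lemma IsIrrigPlan.measurable_Wtil {d : ℕ} {μ : Measure (Euc d)}
    {χ : ℝ → ℝ → Euc d} (h : IsIrrigPlan μ χ) {J : ℝ → ℝ} (hJ : MollKernel2 J) {ε : ℝ}
    (hε : 0 < ε) : Measurable (Wtil μ J ε χ) := by
  obtain ⟨I, hI, hIe⟩ := h.exists_measurable_lineIntegral hJ hε (Set.Ici 0)
  have h1 : Wtil μ J ε χ = fun x => ∫⁻ θ in Theta μ, min 1 (I (x, θ)) := by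
    funext x
    exact setLIntegral_congr_fun (measurableSet_Theta μ) fun θ hθ => by simp only [hIe x θ hθ]
  rw [h1]
  exact Measurable.lintegral_prod_right' (f := fun p : Euc d × ℝ => min 1 (I p))
    (measurable_const.min hI)

lemma eq_of_stopTime_le {d : ℕ} {χ : ℝ → ℝ → Euc d} {θ : ℝ} (hc : Continuous (χ θ))
    (he : ∃ t, 0 < t ∧ ∀ t' ≥ t, χ θ t' = χ θ t) {t : ℝ} (ht : stopTime χ θ ≤ t) :
    χ θ t = χ θ (stopTime χ θ) := by
  have key : ∀ s, stopTime χ θ < s → χ θ s = χ θ t ∨ t < s := by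
    intro s hs
    obtain ⟨r, ⟨-, hr⟩, hrs⟩ := exists_lt_of_csInf_lt he hs
    rcases lt_or_ge t s with hts | hts
    · exact Or.inr hts
    · exact Or.inl ((hr s hrs.le).trans (hr t (hrs.le.trans hts)).symm)
  rcases ht.eq_or_lt with rfl | ht'
  · rfl
  have h1 : Tendsto (χ θ) (𝓝[>] (stopTime χ θ)) (𝓝 (χ θ (stopTime χ θ))) :=
    hc.continuousAt.tendsto.mono_left nhdsWithin_le_nhds
  have h2 : Tendsto (χ θ) (𝓝[>] (stopTime χ θ)) (𝓝 (χ θ t)) := by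
    refine tendsto_const_nhds.congr' ?_
    filter_upwards [Ioo_mem_nhdsGT ht'] with s hs
    exact ((key s hs.1).resolve_right (not_lt.2 hs.2.le)).symm
  exact tendsto_nhds_unique h2 h1

lemma IsIrrigPlan.eq_stopTime {d : ℕ} {μ : Measure (Euc d)} {χ : ℝ → ℝ → Euc d}
    (h : IsIrrigPlan μ χ) {θ : ℝ} (hθ : θ ∈ Theta μ) {t : ℝ} (ht : stopTime χ θ ≤ t) :
    χ θ t = χ θ (stopTime χ θ) :=
  eq_of_stopTime_le (h.lipschitz θ hθ).continuous (h.eventuallyConst θ hθ) ht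

lemma IsIrrigPlan.deriv_eq_zero {d : ℕ} {μ : Measure (Euc d)} {χ : ℝ → ℝ → Euc d}
    (h : IsIrrigPlan μ χ) {θ : ℝ} (hθ : θ ∈ Theta μ) {t : ℝ} (ht : stopTime χ θ < t) :
    deriv (χ θ) t = 0 := by
  have : χ θ =ᶠ[𝓝 t] fun _ => χ θ (stopTime χ θ) := by
    filter_upwards [lt_mem_nhds ht] with s hs
    exact h.eq_stopTime hθ hs.le
  rw [this.deriv_eq]
  simp

lemma IsIrrigPlan.norm_le {d : ℕ} {μ : Measure (Euc d)} {χ : ℝ → ℝ → Euc d}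
    (h : IsIrrigPlan μ χ) {θ : ℝ} (hθ : θ ∈ Theta μ) {t : ℝ} (ht : 0 ≤ t) : ‖χ θ t‖ ≤ t := by
  have := (h.lipschitz θ hθ).dist_le_mul t 0
  simpa [h.init θ hθ, abs_of_nonneg ht] using this

lemma IsIrrigPlan.dist_le_mul_dPath {d : ℕ} {μ : Measure (Euc d)} {χ χ' : ℝ → ℝ → Euc d}
    (h : IsIrrigPlan μ χ) (h' : IsIrrigPlan μ χ') {θ : ℝ} (hθ : θ ∈ Theta μ) (k : ℕ+) {t : ℝ}
    (ht : t ∈ Set.Icc (0:ℝ) k) : dist (χ θ t) (χ' θ t) ≤ k * dPath (χ θ) (χ' θ) := by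
  have hb : ∀ (k : ℕ+) (t : Set.Icc (0:ℝ) ((k : ℕ) : ℝ)),
      dist (χ θ (t : ℝ)) (χ' θ (t : ℝ)) ≤ 2 * k := fun k t => by
    have h1 := h.norm_le hθ t.2.1
    have h2 := h'.norm_le hθ t.2.1
    have h3 := t.2.2
    linarith [dist_le_norm_add_norm (χ θ (t : ℝ)) (χ' θ (t : ℝ))]
  have hk : ∀ k : ℕ+, (0:ℝ) < (k : ℕ) := fun k => by exact_mod_cast k.pos
  have h1 : dist (χ θ t) (χ' θ t) ≤
      ⨆ t : Set.Icc (0:ℝ) ((k : ℕ) : ℝ), dist (χ θ (t : ℝ)) (χ' θ (t : ℝ)) :=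
    le_ciSup (f := fun t : Set.Icc (0:ℝ) ((k : ℕ) : ℝ) => dist (χ θ (t : ℝ)) (χ' θ (t : ℝ)))
      ⟨2 * k, by rintro _ ⟨t, rfl⟩; exact hb k t⟩ ⟨t, ht⟩
  have h2 : (1 / ((k : ℕ) : ℝ)) *
      (⨆ t : Set.Icc (0:ℝ) ((k : ℕ) : ℝ), dist (χ θ (t : ℝ)) (χ' θ (t : ℝ))) ≤
      dPath (χ θ) (χ' θ) := by
    refine le_ciSup (f := fun k : ℕ+ => (1 / ((k : ℕ) : ℝ)) *
      ⨆ t : Set.Icc (0:ℝ) ((k : ℕ) : ℝ), dist (χ θ (t : ℝ)) (χ' θ (t : ℝ))) ⟨2, ?_⟩ k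
    rintro _ ⟨k, rfl⟩
    have : Nonempty (Set.Icc (0:ℝ) ((k : ℕ) : ℝ)) := ⟨⟨0, le_rfl, (hk k).le⟩⟩
    have h3 := ciSup_le (hb k)
    simp only [one_div]
    rw [inv_mul_le_iff₀ (hk k), mul_comm]
    exact h3
  rw [one_div, inv_mul_le_iff₀ (hk k)] at h2
  exact h1.trans h2

/-- `χ_n(θ,·) → χ(θ,·)` locally uniformly along convergent plans. -/
lemma tendsto_dist_of_tendsto_dPath {d : ℕ} {μ : Measure (Euc d)} {χs : ℕ → ℝ → ℝ → Euc d}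
    {χ : ℝ → ℝ → Euc d} (hs : ∀ n, IsIrrigPlan μ (χs n)) (h : IsIrrigPlan μ χ) {θ : ℝ}
    (hθ : θ ∈ Theta μ) (hlim : Tendsto (fun n => dPath (χs n θ) (χ θ)) atTop (𝓝 0)) (K : ℝ)
    {η : ℝ} (hη : 0 < η) :
    ∀ᶠ n in atTop, ∀ t ∈ Set.Icc 0 K, dist (χs n θ t) (χ θ t) < η := by
  obtain ⟨k, hk⟩ := exists_nat_ge K
  have h1 : Tendsto (fun n => (k.succPNat : ℝ) * dPath (χs n θ) (χ θ)) atTop (𝓝 0) := by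
    simpa using hlim.const_mul (k.succPNat : ℝ)
  filter_upwards [h1.eventually_lt_const hη] with n hn t ht
  refine ((hs n).dist_le_mul_dPath h hθ k.succPNat ⟨ht.1, ht.2.trans (hk.trans ?_)⟩).trans_lt hn
  simp

lemma MollKernel2.tendsto_mollifier {J : ℝ → ℝ} (hJ : MollKernel2 J) {εs : ℕ → ℝ}
    (hε : ∀ n, 0 < εs n) (hε0 : Tendsto εs atTop (𝓝 0)) {δ : ℝ} (hδ : 0 < δ) :
    Tendsto (fun n => ENNReal.ofReal ((1 / εs n) * J (δ / εs n))) atTop (𝓝 0) := by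
  have h0 : Tendsto εs atTop (𝓝[>] 0) :=
    tendsto_nhdsWithin_iff.2 ⟨hε0, Eventually.of_forall hε⟩
  have h1 : Tendsto (fun n => δ / εs n) atTop atTop := by
    simp only [div_eq_mul_inv]
    exact h0.inv_tendsto_nhdsGT_zero.const_mul_atTop hδ
  have h2 := (hJ.tendsto_mul_self.comp h1).const_mul (1 / δ)
  rw [mul_zero] at h2
  have h3 : Tendsto (fun n => (1 / εs n) * J (δ / εs n)) atTop (𝓝 0) := by
    refine h2.congr fun n => ?_
    have := (hε n).ne'
    simp only [Function.comp_apply]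
    field_simp
  simpa using ENNReal.tendsto_ofReal h3

/-- Particles whose limit path avoids `x` do not contribute to the limiting multiplicity. -/
lemma tendsto_lineIntegral_of_avoids {d : ℕ} {μ : Measure (Euc d)} {J : ℝ → ℝ}
    (hJ : MollKernel2 J) {εs : ℕ → ℝ} (hε : ∀ n, 0 < εs n) (hε0 : Tendsto εs atTop (𝓝 0))
    {χs : ℕ → ℝ → ℝ → Euc d} {χ : ℝ → ℝ → Euc d} (hs : ∀ n, IsIrrigPlan μ (χs n))
    (h : IsIrrigPlan μ χ) {θ : ℝ} (hθ : θ ∈ Theta μ)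
    (hlim : Tendsto (fun n => dPath (χs n θ) (χ θ)) atTop (𝓝 0))
    {xs : ℕ → Euc d} {x : Euc d} (hx : Tendsto xs atTop (𝓝 x))
    (hav : ¬ ∃ t, 0 ≤ t ∧ χ θ t = x) {K : ℝ} (hK : 0 ≤ K) :
    Tendsto (fun n => ∫⁻ t in Set.Ico (0:ℝ) K,
      ENNReal.ofReal ((1 / εs n) * J (dist (χs n θ t) (xs n) / εs n)) *
        (‖deriv (χs n θ) t‖₊ : ℝ≥0∞)) atTop (𝓝 0) := by
  obtain ⟨t₀, ht₀, hmin⟩ := isCompact_Icc.exists_isMinOn (Set.nonempty_Icc.2 hK)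
    ((h.lipschitz θ hθ).continuous.dist (continuous_const (y := x))).continuousOn
  set δ := dist (χ θ t₀) x with hδd
  have hδ : 0 < δ := dist_pos.2 fun he => hav ⟨t₀, ht₀.1, he⟩
  have h1 := (hJ.tendsto_mollifier hε hε0 (half_pos hδ))
  have h2 : Tendsto (fun n => ENNReal.ofReal ((1 / εs n) * J (δ / 2 / εs n)) * ENNReal.ofReal K)
      atTop (𝓝 0) := by
    simpa using ENNReal.Tendsto.mul_const h1 (Or.inr (ENNReal.ofReal_ne_top (r := K)))
  refine tendsto_of_tendsto_of_tendsto_of_le_of_le' tendsto_const_nhds h2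
    (Eventually.of_forall fun _ => zero_le) ?_
  filter_upwards [tendsto_dist_of_tendsto_dPath hs h hθ hlim K (by positivity : 0 < δ / 4),
    (tendsto_iff_dist_tendsto_zero.1 hx).eventually_lt_const (by positivity : 0 < δ / 4)]
    with n hn1 hn2
  calc _ ≤ ∫⁻ _ in Set.Ico (0:ℝ) K, ENNReal.ofReal ((1 / εs n) * J (δ / 2 / εs n)) := by
        refine setLIntegral_mono' measurableSet_Ico fun t ht => ?_
        refine (mul_le_of_le_one_right zero_le
          (nnnorm_deriv_le_one ((hs n).lipschitz θ hθ) t)).trans ?_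
        have hεn := hε n
        have ht' : t ∈ Set.Icc 0 K := ⟨ht.1, ht.2.le⟩
        have h3 : δ / 2 ≤ dist (χs n θ t) (xs n) := by
          have h4 : δ ≤ dist (χ θ t) x := hmin ht'
          have h5 := hn1 t ht'
          rw [dist_comm] at h5
          linarith [dist_triangle4 (χ θ t) (χs n θ t) (xs n) x]
        gcongr
        refine hJ.2.2.1.antitoneOn (Set.mem_Ici.2 (by positivity))
          (Set.mem_Ici.2 (by positivity)) ?_
        gcongr
    _ = _ := by simp

lemma limsup_Wtil_le_mult {d : ℕ} {μ : Measure (Euc d)} {J : ℝ → ℝ}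
    (hJ : MollKernel2 J) {εs : ℕ → ℝ} (hε : ∀ n, 0 < εs n) (hε0 : Tendsto εs atTop (𝓝 0))
    {χs : ℕ → ℝ → ℝ → Euc d} {χ : ℝ → ℝ → Euc d} (hs : ∀ n, IsIrrigPlan μ (χs n))
    (h : IsIrrigPlan μ χ) (hlim : PlansTendsto μ χs χ) {C : ℝ}
    (hC : ∀ n, ∫⁻ θ in Theta μ, ENNReal.ofReal (stopTime (χs n) θ) ≤ ENNReal.ofReal C)
    {xs : ℕ → Euc d} {x : Euc d} (hx : Tendsto xs atTop (𝓝 x)) :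
    limsup (fun n => Wtil μ J (εs n) (χs n) (xs n)) atTop ≤ mult μ χ x := by
  have hbound : ∀ k : ℕ, limsup (fun n => Wtil μ J (εs n) (χs n) (xs n)) atTop ≤
      ENNReal.ofReal C * ((k + 1 : ℕ) : ℝ≥0∞)⁻¹ + mult μ χ x := by
    intro k
    set K : ℝ := ((k + 1 : ℕ) : ℝ) with hKd
    have hK : 0 < K := by positivity
    choose I hI hIe using fun n =>
      (hs n).exists_measurable_lineIntegral hJ (hε n) (Set.Ico 0 K)
    have hIm : ∀ n, Measurable fun θ => min 1 (I n (xs n, θ)) := fun n =>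
      measurable_const.min ((hI n).comp (by fun_prop : Measurable fun θ : ℝ => (xs n, θ)))
    have hW : ∀ n, Wtil μ J (εs n) (χs n) (xs n) ≤ ENNReal.ofReal C * ((k + 1 : ℕ) : ℝ≥0∞)⁻¹ +
        ∫⁻ θ in Theta μ, min 1 (I n (xs n, θ)) := by
      intro n
      calc Wtil μ J (εs n) (χs n) (xs n)
          ≤ ∫⁻ θ in Theta μ, (ENNReal.ofReal (stopTime (χs n) θ) * ((k + 1 : ℕ) : ℝ≥0∞)⁻¹ +
              min 1 (I n (xs n, θ))) := by
            refine setLIntegral_mono' (measurableSet_Theta μ) fun θ hθ => ?_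
            rcases lt_or_ge (stopTime (χs n) θ) K with hT | hT
            · refine le_add_of_nonneg_of_le zero_le (min_le_min le_rfl ?_)
              rw [← hIe n _ _ hθ, ← Set.Ico_union_Ici_eq_Ici hK.le]
              refine (lintegral_union_le _ _ _).trans (add_le_of_le_of_nonpos le_rfl ?_)
              refine (setLIntegral_mono' measurableSet_Ici (g := fun _ => 0)
                fun t ht => ?_).trans (by simp)
              simp [(hs n).deriv_eq_zero hθ (hT.trans_le ht)]
            · refine (min_le_left _ _).trans (le_add_of_le_of_nonneg ?_ zero_le)
              rw [← div_eq_mul_inv, ENNReal.le_div_iff_mul_le (by simp) (by simp), one_mul,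
                ← ENNReal.ofReal_natCast]
              exact ENNReal.ofReal_le_ofReal hT
        _ = (∫⁻ θ in Theta μ, ENNReal.ofReal (stopTime (χs n) θ)) * ((k + 1 : ℕ) : ℝ≥0∞)⁻¹ +
            ∫⁻ θ in Theta μ, min 1 (I n (xs n, θ)) := by
            rw [lintegral_add_right _ (hIm n), lintegral_mul_const' _ _ (by simp)]
        _ ≤ _ := by gcongr; exact hC n
    have hL : limsup (fun n => ∫⁻ θ in Theta μ, min 1 (I n (xs n, θ))) atTop ≤ mult μ χ x := by
      calc _ ≤ ∫⁻ θ in Theta μ, limsup (fun n => min 1 (I n (xs n, θ))) atTop :=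
            limsup_lintegral_le (fun _ => 1) hIm
              (fun n => Eventually.of_forall fun θ => min_le_left _ _)
              (by simpa using volume_Theta_ne_top μ)
        _ ≤ ∫⁻ θ in Theta μ, {θ | ∃ t, 0 ≤ t ∧ χ θ t = x}.indicator 1 θ := by
            refine lintegral_mono_ae ?_
            filter_upwards [hlim, ae_restrict_mem (measurableSet_Theta μ)] with θ hθl hθ
            by_cases hav : ∃ t, 0 ≤ t ∧ χ θ t = x
            · rw [Set.indicator_of_mem (by exact hav)]
              exact limsup_le_of_le (h := Eventually.of_forall fun n => min_le_left _ _)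
            · have h1 := tendsto_lineIntegral_of_avoids hJ hε hε0 hs h hθ hθl hx hav hK.le
              simp only [hIe _ _ _ hθ] at h1
              rw [Set.indicator_of_notMem (by exact hav), ← h1.limsup_eq]
              exact limsup_le_limsup (Eventually.of_forall fun n => min_le_right _ _)
        _ ≤ _ := by
            refine (lintegral_indicator_one_le _).trans (le_of_eq ?_)
            rw [Measure.restrict_apply' (measurableSet_Theta μ), mult]
            congr 1
            ext θ
            simp [and_comm]
    calc _ ≤ limsup (fun n => ENNReal.ofReal C * ((k + 1 : ℕ) : ℝ≥0∞)⁻¹ +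
            ∫⁻ θ in Theta μ, min 1 (I n (xs n, θ))) atTop :=
          limsup_le_limsup (Eventually.of_forall hW)
      _ = ENNReal.ofReal C * ((k + 1 : ℕ) : ℝ≥0∞)⁻¹ +
            limsup (fun n => ∫⁻ θ in Theta μ, min 1 (I n (xs n, θ))) atTop :=
          limsup_const_add atTop _ _ (by isBoundedDefault) (by isBoundedDefault)
      _ ≤ _ := by gcongr
  have h1 : Tendsto (fun k : ℕ => ((k + 1 : ℕ) : ℝ≥0∞)⁻¹) atTop (𝓝 0) :=
    (tendsto_add_atTop_iff_nat 1).2 ENNReal.tendsto_inv_nat_nhds_zero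
  have h2 := (ENNReal.Tendsto.const_mul h1
    (Or.inr (ENNReal.ofReal_ne_top (r := C)))).add_const (mult μ χ x)
  rw [mul_zero, zero_add] at h2
  exact ge_of_tendsto' h2 hbound

lemma ENNReal.antitone_rpow_of_nonpos {p : ℝ} (hp : p ≤ 0) : Antitone fun y : ℝ≥0∞ => y ^ p := by
  intro a b hab
  have h1 : ∀ y : ℝ≥0∞, y ^ p = (y ^ (-p))⁻¹ := fun y => by rw [ENNReal.rpow_neg, inv_inv]
  simp only [h1]
  exact ENNReal.inv_le_inv.2 (ENNReal.rpow_le_rpow hab (by linarith))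

lemma ENNReal.rpow_le_liminf_rpow_of_nonpos {u : ℕ → ℝ≥0∞} {m : ℝ≥0∞} {p : ℝ} (hp : p ≤ 0)
    (hu : limsup u atTop ≤ m) : m ^ p ≤ liminf (fun n => u n ^ p) atTop := by
  have hanti := ENNReal.antitone_rpow_of_nonpos hp
  have := hanti.map_limsup_of_continuousAt u (F := atTop)
    (ENNReal.continuous_rpow_const (y := p)).continuousAt
  calc m ^ p ≤ (limsup u atTop) ^ p := hanti hu
    _ = _ := this

lemma eventually_lt_stopTime {d : ℕ} {μ : Measure (Euc d)}
    {χs : ℕ → ℝ → ℝ → Euc d} {χ : ℝ → ℝ → Euc d} (hs : ∀ n, IsIrrigPlan μ (χs n))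
    (h : IsIrrigPlan μ χ) {θ : ℝ} (hθ : θ ∈ Theta μ)
    (hlim : Tendsto (fun n => dPath (χs n θ) (χ θ)) atTop (𝓝 0)) {t : ℝ} (ht0 : 0 < t)
    (ht : t < stopTime χ θ) : ∀ᶠ n in atTop, t < stopTime (χs n) θ := by
  by_contra hcon
  rw [not_eventually] at hcon
  refine absurd ht (not_lt.2 (csInf_le ⟨0, fun s hs => hs.1.le⟩ ⟨ht0, fun t' ht' => ?_⟩))
  refine eq_of_forall_dist_le fun η hη => ?_
  obtain ⟨n, hn1, hn2⟩ := (hcon.and_eventually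
    (tendsto_dist_of_tendsto_dPath hs h hθ hlim t' (half_pos hη))).exists
  have hn1' := not_lt.1 hn1
  have he : χs n θ t' = χs n θ t := by
    rw [(hs n).eq_stopTime hθ hn1', (hs n).eq_stopTime hθ (hn1'.trans ht')]
  have h1 := hn2 t' ⟨ht0.le.trans ht', le_rfl⟩
  have h2 := hn2 t ⟨ht0.le, ht'⟩
  rw [he, dist_comm] at h1
  linarith [dist_triangle (χ θ t') (χs n θ t) (χ θ t)]

theorem irrCost_le_liminf_Etil {d : ℕ} {μ : Measure (Euc d)} {J : ℝ → ℝ}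
    (hJ : MollKernel2 J) {α : ℝ} (hα : α ≤ 1) {εs : ℕ → ℝ} (hε : ∀ n, 0 < εs n)
    (hε0 : Tendsto εs atTop (𝓝 0)) {χs : ℕ → ℝ → ℝ → Euc d} {χ : ℝ → ℝ → Euc d}
    (hs : ∀ n, IsIrrigPlan μ (χs n)) (harc : ∀ n, ArcLength μ (χs n)) (h : IsIrrigPlan μ χ)
    (hlim : PlansTendsto μ χs χ) {C : ℝ}
    (hC : ∀ n, ∫⁻ θ in Theta μ, ENNReal.ofReal (stopTime (χs n) θ) ≤ ENNReal.ofReal C) :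
    irrCost μ α χ ≤ liminf (fun n => Etil μ J α (εs n) (χs n)) atTop := by
  choose D hD hDe using fun n => (hs n).exists_measurable_speed
  set F : ℕ → ℝ × ℝ → ℝ≥0∞ := fun n p =>
    (Wtil μ J (εs n) (χs n) (χs n p.1 p.2)) ^ (α - 1) * D n p with hF
  have hFm : ∀ n, Measurable (F n) := fun n => by
    have h1 : Measurable fun p : ℝ × ℝ => χs n p.1 p.2 := (hs n).measurable
    exact ((((hs n).measurable_Wtil hJ (hε n)).comp h1).pow_const _).mul (hD n)
  have hE : ∀ n, Etil μ J α (εs n) (χs n) =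
      ∫⁻ θ in Theta μ, ∫⁻ t in Set.Ici (0:ℝ), F n (θ, t) := fun n => by
    refine setLIntegral_congr_fun (measurableSet_Theta μ) fun θ hθ => lintegral_congr_ae ?_
    filter_upwards [ae_restrict_of_ae (hDe n θ hθ)] with t ht
    simp only [hF, ht]
  simp only [hE]
  refine le_trans ?_ (lintegral_liminf_le fun n => (hFm n).lintegral_prod_right')
  refine lintegral_mono_ae ?_
  filter_upwards [hlim, ae_restrict_mem (measurableSet_Theta μ)] with θ hθl hθ
  refine le_trans ?_ (lintegral_liminf_le fun n =>
    (hFm n).comp (by fun_prop : Measurable fun t : ℝ => (θ, t)))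
  refine lintegral_mono_ae ?_
  have hne : ∀ s : ℝ, ∀ᵐ t ∂(volume : Measure ℝ), t ≠ s := fun s => by
    simp [ae_iff]
  filter_upwards [ae_restrict_of_ae (ae_all_iff.2 fun n => hDe n θ hθ),
    ae_restrict_of_ae (ae_all_iff.2 fun n => harc n θ hθ), ae_restrict_mem measurableSet_Ici,
    ae_restrict_of_ae (hne 0), ae_restrict_of_ae (hne (stopTime χ θ))] with t htD htarc ht htz htT
  have ht0 : 0 < t := lt_of_le_of_ne ht htz.symm
  rcases htT.lt_or_gt with htT | htT
  · have hxl : Tendsto (fun n => χs n θ t) atTop (𝓝 (χ θ t)) := by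
      refine Metric.tendsto_atTop'.2 fun η hη => ?_
      obtain ⟨N, hN⟩ := eventually_atTop.1 (tendsto_dist_of_tendsto_dPath hs h hθ hθl t hη)
      exact ⟨N, fun n hn => hN n hn.le t ⟨ht, le_rfl⟩⟩
    refine (mul_le_of_le_one_right zero_le
      (nnnorm_deriv_le_one (h.lipschitz θ hθ) t)).trans ?_
    refine (ENNReal.rpow_le_liminf_rpow_of_nonpos (by linarith)
      (limsup_Wtil_le_mult hJ hε hε0 hs h hlim hC hxl)).trans (le_of_eq (liminf_congr ?_))
    filter_upwards [eventually_lt_stopTime hs h hθ hθl ht0 htT] with n hn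
    have h1 : ‖deriv (χs n θ) t‖₊ = 1 := NNReal.eq ((htarc n).1 ht0 hn)
    simp [hF, ← htD n, h1]
  · simp [h.deriv_eq_zero hθ htT]

/-- The plan in which every particle first travels from the origin to `ℓ • e` and back, and then
follows `χ`. -/
def loopPlan {d : ℕ} (e : Euc d) (ℓ : ℝ) (χ : ℝ → ℝ → Euc d) (θ t : ℝ) : Euc d :=
  if t ≤ 2 * ℓ then max 0 (min t (2 * ℓ - t)) • e else χ θ (t - 2 * ℓ)

section LoopPlan

variable {d : ℕ} {μ : Measure (Euc d)} {χ : ℝ → ℝ → Euc d} {e : Euc d} {ℓ : ℝ}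

lemma loopPlan_of_le {θ t : ℝ} (ht : t ≤ 2 * ℓ) :
    loopPlan e ℓ χ θ t = max 0 (min t (2 * ℓ - t)) • e := if_pos ht

lemma IsIrrigPlan.loopPlan_of_ge (h : IsIrrigPlan μ χ) {θ t : ℝ} (hθ : θ ∈ Theta μ)
    (ht : 2 * ℓ ≤ t) : loopPlan e ℓ χ θ t = χ θ (t - 2 * ℓ) := by
  rcases ht.eq_or_lt with rfl | ht
  · simp [loopPlan, h.init θ hθ]
  · exact if_neg (not_le.2 ht)

lemma IsIrrigPlan.lipschitzWith_loopPlan (h : IsIrrigPlan μ χ) (he : ‖e‖ = 1) {θ : ℝ}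
    (hθ : θ ∈ Theta μ) : LipschitzWith 1 (loopPlan e ℓ χ θ) := by
  have h1 : ∀ s t, s ≤ t → t ≤ 2 * ℓ →
      dist (loopPlan e ℓ χ θ s) (loopPlan e ℓ χ θ t) ≤ t - s := by
    intro s t hst ht
    rw [loopPlan_of_le ht, loopPlan_of_le (hst.trans ht), dist_eq_norm, ← sub_smul, norm_smul, he,
      mul_one, Real.norm_eq_abs]
    refine (abs_max_sub_max_le_max _ _ _ _).trans (max_le (by simpa using hst) ?_)
    refine (abs_min_sub_min_le_max _ _ _ _).trans (max_le ?_ ?_)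
    · rw [abs_sub_comm, abs_of_nonneg (by linarith)]
    · rw [abs_of_nonneg (by linarith)]
      linarith
  have h2 : ∀ s t, s ≤ t → 2 * ℓ ≤ s →
      dist (loopPlan e ℓ χ θ s) (loopPlan e ℓ χ θ t) ≤ t - s := by
    intro s t hst hs
    rw [h.loopPlan_of_ge hθ hs, h.loopPlan_of_ge hθ (hs.trans hst)]
    refine ((h.lipschitz θ hθ).dist_le_mul _ _).trans ?_
    rw [NNReal.coe_one, one_mul, Real.dist_eq, abs_sub_comm, abs_of_nonneg (by linarith)]
    linarith
  have h3 : ∀ s t, s ≤ t → dist (loopPlan e ℓ χ θ s) (loopPlan e ℓ χ θ t) ≤ t - s := by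
    intro s t hst
    rcases le_total t (2 * ℓ) with ht | ht
    · exact h1 s t hst ht
    rcases le_total (2 * ℓ) s with hs | hs
    · exact h2 s t hst hs
    linarith [h1 s (2 * ℓ) hs le_rfl, h2 (2 * ℓ) t ht le_rfl,
      dist_triangle (loopPlan e ℓ χ θ s) (loopPlan e ℓ χ θ (2 * ℓ)) (loopPlan e ℓ χ θ t)]
  refine LipschitzWith.of_dist_le_mul fun s t => ?_
  rw [NNReal.coe_one, one_mul, Real.dist_eq]
  rcases le_total s t with hst | hst
  · rw [abs_sub_comm, abs_of_nonneg (by linarith)]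
    exact h3 s t hst
  · rw [dist_comm, abs_of_nonneg (by linarith)]
    exact h3 t s hst

lemma IsIrrigPlan.loopPlan (h : IsIrrigPlan μ χ) (he : ‖e‖ = 1) (hℓ : 0 ≤ ℓ) :
    IsIrrigPlan μ (loopPlan e ℓ χ) := by
  have hconst : ∀ θ ∈ Theta μ, ∀ t, stopTime χ θ + 2 * ℓ ≤ t →
      _root_.loopPlan e ℓ χ θ t = χ θ (stopTime χ θ) := fun θ hθ t ht => by
    have h0 : 0 ≤ stopTime χ θ := Real.sInf_nonneg fun _ ht => ht.1.le
    rw [h.loopPlan_of_ge hθ (by linarith), h.eq_stopTime hθ (by linarith)]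
  have hev : ∀ θ ∈ Theta μ, ∃ t, 0 < t ∧
      ∀ t' ≥ t, _root_.loopPlan e ℓ χ θ t' = _root_.loopPlan e ℓ χ θ t := fun θ hθ => by
    have h0 : 0 ≤ stopTime χ θ := Real.sInf_nonneg fun _ ht => ht.1.le
    refine ⟨stopTime χ θ + 2 * ℓ + 1, by positivity, fun t' ht' => ?_⟩
    rw [hconst θ hθ t' (by linarith), hconst θ hθ (stopTime χ θ + 2 * ℓ + 1) (by linarith)]
  refine ⟨?_, fun θ hθ => h.lipschitzWith_loopPlan he hθ, hev, fun θ hθ => ?_, ?_⟩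
  · have h1 : Measurable fun p : ℝ × ℝ => χ p.1 (p.2 - 2 * ℓ) :=
      h.measurable.comp (by fun_prop : Measurable fun p : ℝ × ℝ => (p.1, p.2 - 2 * ℓ))
    have h2 : Measurable fun p : ℝ × ℝ => max 0 (min p.2 (2 * ℓ - p.2)) • e := by fun_prop
    exact Measurable.ite (measurableSet_le measurable_snd measurable_const) h2 h1
  · rw [loopPlan_of_le (by positivity)]
    simp [hℓ]
  · refine (Measure.map_congr ?_).trans h.pushforward
    filter_upwards [ae_restrict_mem (measurableSet_Theta μ)] with θ hθ
    rw [← hconst θ hθ _ (le_max_left _ (stopTime (_root_.loopPlan e ℓ χ) θ))]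
    exact (eq_of_stopTime_le (h.lipschitzWith_loopPlan he hθ).continuous (hev θ hθ)
      (le_max_right _ _)).symm

lemma IsIrrigPlan.dPath_loopPlan_le (h : IsIrrigPlan μ χ) (he : ‖e‖ = 1) (hℓ : 0 ≤ ℓ) {θ : ℝ}
    (hθ : θ ∈ Theta μ) : dPath (_root_.loopPlan e ℓ χ θ) (χ θ) ≤ 4 * ℓ := by
  have h1 : ∀ t, 0 ≤ t → dist (_root_.loopPlan e ℓ χ θ t) (χ θ t) ≤ 4 * ℓ := by
    intro t ht
    rcases le_total t (2 * ℓ) with htl | htl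
    · linarith [(h.loopPlan he hℓ).norm_le hθ ht, h.norm_le hθ ht,
        dist_le_norm_add_norm (_root_.loopPlan e ℓ χ θ t) (χ θ t)]
    · rw [h.loopPlan_of_ge hθ htl]
      refine ((h.lipschitz θ hθ).dist_le_mul _ _).trans ?_
      rw [NNReal.coe_one, one_mul, Real.dist_eq, abs_sub_comm, abs_of_nonneg (by linarith)]
      linarith
  refine ciSup_le fun k => ?_
  have hk : (1:ℝ) ≤ (k : ℕ) := Nat.one_le_cast.2 k.pos
  have : Nonempty (Set.Icc (0:ℝ) ((k : ℕ) : ℝ)) := ⟨⟨0, le_rfl, by linarith⟩⟩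
  have h2 : (⨆ t : Set.Icc (0:ℝ) ((k : ℕ) : ℝ),
      dist (_root_.loopPlan e ℓ χ θ (t : ℝ)) (χ θ (t : ℝ))) ≤ 4 * ℓ :=
    ciSup_le fun t => h1 t t.2.1
  refine (mul_le_mul_of_nonneg_left h2 (by positivity)).trans ?_
  refine mul_le_of_le_one_left (by positivity) ?_
  rw [one_div]
  exact inv_le_one_of_one_le₀ hk

lemma dPath_nonneg (γ₀ γ₁ : ℝ → Euc d) : 0 ≤ dPath γ₀ γ₁ :=
  Real.iSup_nonneg fun _ => mul_nonneg (by positivity) (Real.iSup_nonneg fun _ => dist_nonneg)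

lemma IsIrrigPlan.mult_le_mult_loopPlan (h : IsIrrigPlan μ χ) (hℓ : 0 ≤ ℓ) (x : Euc d) :
    mult μ χ x ≤ mult μ (_root_.loopPlan e ℓ χ) x := by
  refine measure_mono ?_
  rintro θ ⟨hθ, t, ht, rfl⟩
  refine ⟨hθ, t + 2 * ℓ, by positivity, ?_⟩
  rw [h.loopPlan_of_ge hθ (by linarith), add_sub_cancel_right]

lemma volume_Theta_le_mult_loopPlan {θ t : ℝ} (ht : t ∈ Set.Icc 0 (2 * ℓ)) :
    volume (Theta μ) ≤ mult μ (loopPlan e ℓ χ) (loopPlan e ℓ χ θ t) := by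
  refine measure_mono fun θ' hθ' => ⟨hθ', t, ht.1, ?_⟩
  rw [loopPlan_of_le ht.2, loopPlan_of_le ht.2]

/-- If every path gets at distance at least `δ` from each point, the mollified multiplicity
controls the multiplicity. -/
lemma IsIrrigPlan.mul_mult_le_Wtil (h : IsIrrigPlan μ χ) {J : ℝ → ℝ} (hJ : MollKernel2 J) {ε : ℝ}
    (hε : 0 < ε) {δ : ℝ} (hδ : 0 ≤ δ) {x : Euc d}
    (hfar : ∀ θ ∈ Theta μ, ∃ t, 0 ≤ t ∧ δ ≤ dist (χ θ t) x) :
    min 1 (ENNReal.ofReal (∫ s in (0:ℝ)..(δ / ε), J s)) * mult μ χ x ≤ Wtil μ J ε χ x := by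
  obtain ⟨I, hI, hIe⟩ := h.exists_measurable_lineIntegral hJ hε (Set.Ici 0)
  have hm : Measurable fun θ => min 1 (I (x, θ)) :=
    measurable_const.min (hI.comp (by fun_prop : Measurable fun θ : ℝ => (x, θ)))
  have hW : Wtil μ J ε χ x = ∫⁻ θ in Theta μ, min 1 (I (x, θ)) :=
    setLIntegral_congr_fun (measurableSet_Theta μ) fun θ hθ => by simp only [hIe x θ hθ]
  rw [hW]
  refine le_trans ?_ (mul_meas_ge_le_lintegral hm
    (min 1 (ENNReal.ofReal (∫ s in (0:ℝ)..(δ / ε), J s))))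
  gcongr
  rw [Measure.restrict_apply' (measurableSet_Theta μ)]
  refine measure_mono ?_
  rintro θ ⟨hθ, t₀, ht₀, hx⟩
  obtain ⟨t₁, ht₁, hd⟩ := hfar θ hθ
  refine ⟨min_le_min (le_refl (1 : ℝ≥0∞)) ?_, hθ⟩
  rw [← hIe x θ hθ]
  exact hJ.ofReal_integral_le_lintegral hε (h.lipschitz θ hθ) ht₀ ht₁ hx hδ hd

lemma half_le_dist_loopPlan (he : ‖e‖ = 1) (hℓ : 0 ≤ ℓ) (θ : ℝ) (x : Euc d) :
    ∃ t, 0 ≤ t ∧ ℓ / 2 ≤ dist (loopPlan e ℓ χ θ t) x := by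
  have h0 : loopPlan e ℓ χ θ 0 = 0 := by
    rw [loopPlan_of_le (by positivity)]
    simp [hℓ]
  have h1 : loopPlan e ℓ χ θ ℓ = ℓ • e := by
    rw [loopPlan_of_le (by linarith), min_eq_left (by linarith), max_eq_right hℓ]
  by_contra! hcon
  have h2 := hcon 0 le_rfl
  have h3 := hcon ℓ hℓ
  rw [dist_comm] at h3
  have h4 : dist (loopPlan e ℓ χ θ 0) (loopPlan e ℓ χ θ ℓ) = ℓ := by
    rw [h0, h1, dist_zero_left, norm_smul, he, mul_one, Real.norm_of_nonneg hℓ]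
  linarith [dist_triangle (loopPlan e ℓ χ θ 0) x (loopPlan e ℓ χ θ ℓ)]

lemma IsIrrigPlan.Etil_loopPlan_le (h : IsIrrigPlan μ χ) (he : ‖e‖ = 1) (hℓ : 0 < ℓ) {J : ℝ → ℝ}
    (hJ : MollKernel2 J) {ε : ℝ} (hε : 0 < ε) {α : ℝ} (hα : α ≤ 1) :
    Etil μ J α ε (_root_.loopPlan e ℓ χ) ≤
      (min 1 (ENNReal.ofReal (∫ s in (0:ℝ)..(ℓ / 2 / ε), J s))) ^ (α - 1) *
        (volume (Theta μ) ^ (α - 1) * volume (Theta μ) * ENNReal.ofReal (2 * ℓ) +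
          irrCost μ α χ) := by
  set c := min 1 (ENNReal.ofReal (∫ s in (0:ℝ)..(ℓ / 2 / ε), J s)) with hc
  set χ' := _root_.loopPlan e ℓ χ with hχ'
  have h' : IsIrrigPlan μ χ' := h.loopPlan he hℓ.le
  have hct : c ≠ ∞ := ne_top_of_le_ne_top ENNReal.one_ne_top (min_le_left _ _)
  have hc0 : c ≠ 0 := by
    refine (lt_min one_pos (ENNReal.ofReal_pos.2 ?_)).ne'
    have hr : 0 < ℓ / 2 / ε := by positivity
    exact intervalIntegral.intervalIntegral_pos_of_pos_on
      (hJ.intervalIntegrable le_rfl hr.le) (fun s hs => hJ.2.1 s hs.1.le) hr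
  have hcp : c ^ (α - 1) ≠ ∞ := by simp [ENNReal.rpow_eq_top_iff, hct, hc0]
  have hW : ∀ (x : Euc d) (m : ℝ≥0∞), m ≤ mult μ χ' x →
      Wtil μ J ε χ' x ^ (α - 1) ≤ c ^ (α - 1) * m ^ (α - 1) := fun x m hm => by
    have h1 : c * m ≤ Wtil μ J ε χ' x := (mul_le_mul_right hm c).trans
      (h'.mul_mult_le_Wtil hJ hε (by positivity)
        fun θ _ => half_le_dist_loopPlan he hℓ.le θ x)
    refine (ENNReal.antitone_rpow_of_nonpos (by linarith) h1).trans (le_of_eq ?_)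
    simp only [ENNReal.mul_rpow_eq_ite, hct, hc0, false_and, or_self, if_false]
  have hinner : ∀ θ ∈ Theta μ, (∫⁻ t in Set.Ici (0:ℝ),
      (Wtil μ J ε χ' (χ' θ t)) ^ (α - 1) * (‖deriv (χ' θ) t‖₊ : ℝ≥0∞)) ≤
      c ^ (α - 1) * (volume (Theta μ) ^ (α - 1) * ENNReal.ofReal (2 * ℓ) +
        ∫⁻ t in Set.Ici (0:ℝ), (mult μ χ (χ θ t)) ^ (α - 1) * (‖deriv (χ θ) t‖₊ : ℝ≥0∞)) := by
    intro θ hθ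
    nth_rw 1 [← Set.Icc_union_Ioi_eq_Ici (by positivity : 0 ≤ 2 * ℓ)]
    rw [mul_add]
    refine (lintegral_union_le _ _ _).trans (add_le_add ?_ ?_)
    · calc _ ≤ ∫⁻ _ in Set.Icc (0:ℝ) (2 * ℓ), c ^ (α - 1) * volume (Theta μ) ^ (α - 1) :=
            setLIntegral_mono' measurableSet_Icc fun t ht =>
              (mul_le_of_le_one_right zero_le
                (nnnorm_deriv_le_one (h'.lipschitz θ hθ) t)).trans
                (hW _ _ (volume_Theta_le_mult_loopPlan ht))
        _ = _ := by simp [mul_assoc]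
    · set f : ℝ → ℝ≥0∞ := fun t =>
        (mult μ χ (χ θ t)) ^ (α - 1) * (‖deriv (χ θ) t‖₊ : ℝ≥0∞) with hf
      calc _ ≤ ∫⁻ t in Set.Ioi (2 * ℓ), c ^ (α - 1) * f (t - 2 * ℓ) := by
            refine setLIntegral_mono' measurableSet_Ioi fun t ht => ?_
            have hχt : χ' θ t = χ θ (t - 2 * ℓ) := h.loopPlan_of_ge hθ (le_of_lt ht)
            have hdt : deriv (χ' θ) t = deriv (χ θ) (t - 2 * ℓ) := by
              have : χ' θ =ᶠ[𝓝 t] fun s => χ θ (s - 2 * ℓ) := by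
                filter_upwards [lt_mem_nhds ht] with s hs
                exact h.loopPlan_of_ge hθ hs.le
              rw [this.deriv_eq, deriv_comp_sub_const]
            rw [hdt, hχt, ← mul_assoc]
            gcongr
            exact hW _ _ (h.mult_le_mult_loopPlan hℓ.le _)
        _ = c ^ (α - 1) * ∫⁻ t in Set.Ioi (2 * ℓ), f (t - 2 * ℓ) := lintegral_const_mul' _ _ hcp
        _ = c ^ (α - 1) * ∫⁻ t in Set.Ioi 0, f t := by
            have := (measurePreserving_sub_right volume (2 * ℓ)).setLIntegral_comp_preimage_emb
              (MeasurableEquiv.subRight (2 * ℓ)).measurableEmbedding f (Set.Ioi 0)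
            rw [← this]
            simp
        _ ≤ _ := mul_le_mul_right (lintegral_mono_set Set.Ioi_subset_Ici_self) _
  calc Etil μ J α ε χ' ≤ _ := setLIntegral_mono' (measurableSet_Theta μ) hinner
    _ = c ^ (α - 1) * (∫⁻ θ in Theta μ, (volume (Theta μ) ^ (α - 1) * ENNReal.ofReal (2 * ℓ) +
        ∫⁻ t in Set.Ici (0:ℝ), (mult μ χ (χ θ t)) ^ (α - 1) *
          (‖deriv (χ θ) t‖₊ : ℝ≥0∞))) := lintegral_const_mul' _ _ hcp
    _ = _ := by
      rw [lintegral_add_left measurable_const, setLIntegral_const, irrCost, mul_right_comm]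

end LoopPlan

lemma tendsto_sqrt_div_two_div {εs : ℕ → ℝ} (hε : ∀ n, 0 < εs n)
    (hε0 : Tendsto εs atTop (𝓝 0)) : Tendsto (fun n => √(εs n) / 2 / εs n) atTop atTop := by
  have h0 : Tendsto (fun n => √(εs n)) atTop (𝓝[>] 0) :=
    tendsto_nhdsWithin_iff.2 ⟨by simpa using hε0.sqrt,
      Eventually.of_forall fun n => Real.sqrt_pos.2 (hε n)⟩
  refine (h0.inv_tendsto_nhdsGT_zero.const_mul_atTop (by norm_num : (0:ℝ) < 1 / 2)).congr
    fun n => ?_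
  have h1 := (Real.sqrt_pos.2 (hε n)).ne'
  have h2 := Real.mul_self_sqrt (hε n).le
  simp only [Pi.inv_apply]
  rw [div_div]
  nth_rw 3 [← h2]
  field_simp

theorem exists_recovery_plans {d : ℕ} (hd : 1 ≤ d) {μ : Measure (Euc d)} {J : ℝ → ℝ}
    (hJ : MollKernel2 J) {α : ℝ} (hα : α ≤ 1) {εs : ℕ → ℝ} (hε : ∀ n, 0 < εs n)
    (hε0 : Tendsto εs atTop (𝓝 0)) {χ : ℝ → ℝ → Euc d} (h : IsIrrigPlan μ χ) :
    ∃ χs : ℕ → ℝ → ℝ → Euc d, (∀ n, IsIrrigPlan μ (χs n)) ∧ PlansTendsto μ χs χ ∧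
      limsup (fun n => Etil μ J α (εs n) (χs n)) atTop ≤ irrCost μ α χ := by
  obtain ⟨e, he⟩ : ∃ e : Euc d, ‖e‖ = 1 := ⟨EuclideanSpace.single ⟨0, hd⟩ 1, by simp⟩
  have hs0 : Tendsto (fun n => √(εs n)) atTop (𝓝 0) := by simpa using hε0.sqrt
  refine ⟨fun n => loopPlan e (√(εs n)) χ, fun n => h.loopPlan he (Real.sqrt_nonneg _), ?_, ?_⟩
  · filter_upwards [ae_restrict_mem (measurableSet_Theta μ)] with θ hθ
    exact squeeze_zero (fun n => dPath_nonneg _ _)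
      (fun n => h.dPath_loopPlan_le he (Real.sqrt_nonneg _) hθ) (by simpa using hs0.const_mul 4)
  · refine (limsup_le_limsup (Eventually.of_forall fun n =>
      h.Etil_loopPlan_le he (Real.sqrt_pos.2 (hε n)) hJ (hε n) hα)).trans (le_of_eq ?_)
    have hc : Tendsto (fun n =>
        (min 1 (ENNReal.ofReal (∫ s in (0:ℝ)..(√(εs n) / 2 / εs n), J s))) ^ (α - 1))
        atTop (𝓝 1) := by
      have h1 := tendsto_const_nhds (x := (1 : ℝ≥0∞)).min (ENNReal.tendsto_ofReal
        (hJ.tendsto_intervalIntegral.comp (tendsto_sqrt_div_two_div hε hε0)))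
      rw [min_eq_left (ENNReal.one_le_ofReal.2 hJ.2.2.2.2)] at h1
      simpa using h1.ennrpow_const (α - 1)
    have hV : volume (Theta μ) ^ (α - 1) * volume (Theta μ) ≠ ∞ := by
      rcases eq_or_ne (volume (Theta μ)) 0 with hV0 | hV0
      · simp [hV0]
      · exact ENNReal.mul_ne_top (by simp [ENNReal.rpow_eq_top_iff, hV0, volume_Theta_ne_top μ])
          (volume_Theta_ne_top μ)
    have hl : Tendsto (fun n => volume (Theta μ) ^ (α - 1) * volume (Theta μ) *
        ENNReal.ofReal (2 * √(εs n)) + irrCost μ α χ) atTop (𝓝 (irrCost μ α χ)) := by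
      have h1 : Tendsto (fun n => ENNReal.ofReal (2 * √(εs n))) atTop (𝓝 0) := by
        simpa using ENNReal.tendsto_ofReal (hs0.const_mul 2)
      have h2 := (ENNReal.Tendsto.const_mul h1 (Or.inr hV)).add_const (irrCost μ α χ)
      rwa [mul_zero, zero_add] at h2
    have hlim := ENNReal.Tendsto.mul hc (Or.inl one_ne_zero) hl (Or.inr ENNReal.one_ne_top)
    rw [one_mul] at hlim
    exact hlim.limsup_eq

/-- `Γ`-convergence of the alternative mollified irrigation costs
`Ẽ^α_ε` to `E^α`. -/
theorem alt_mollified_cost_gamma_convergence {d : ℕ} (hd : 1 ≤ d)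
    (μ : Measure (Euc d)) [IsFiniteMeasure μ]
    (hsupp : ∃ R : ℝ, μ (Metric.closedBall 0 R)ᶜ = 0)
    (J : ℝ → ℝ) (hJ : MollKernel2 J)
    (α : ℝ) (hα : α ∈ Set.Icc (0:ℝ) 1) :
    ∀ εs : ℕ → ℝ, (∀ n, 0 < εs n) → Tendsto εs atTop (𝓝 0) →
      -- (Γ1)
      ((∀ (χs : ℕ → ℝ → ℝ → Euc d) (χ : ℝ → ℝ → Euc d) (C : ℝ), 0 < C →
          (∀ n, IsIrrigPlan μ (χs n)) → (∀ n, ArcLength μ (χs n)) →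
          IsIrrigPlan μ χ → PlansTendsto μ χs χ →
          (∀ n, ∫⁻ θ in Theta μ, ENNReal.ofReal (stopTime (χs n) θ) ≤ ENNReal.ofReal C) →
          irrCost μ α χ ≤ Filter.liminf (fun n => Etil μ J α (εs n) (χs n)) atTop) ∧
      -- (Γ2)
       (∀ χ : ℝ → ℝ → Euc d, IsIrrigPlan μ χ →
          ∃ χs : ℕ → ℝ → ℝ → Euc d, (∀ n, IsIrrigPlan μ (χs n)) ∧
            PlansTendsto μ χs χ ∧
            Filter.limsup (fun n => Etil μ J α (εs n) (χs n)) atTop ≤ irrCost μ α χ)) := by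
  intro εs hε hε0
  refine ⟨fun χs χ C _ hs harc h hlim hC => ?_, fun χ h => ?_⟩
  · exact irrCost_le_liminf_Etil hJ hα.2 hε hε0 hs harc h hlim hC
  · exact exists_recovery_plans hd hJ hα.2 hε hε0 h

end
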